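/- arXiv:2211.17245 — 4 statements merged into one kernel-verified Lean document; each statement's English description precedes it below -/
import Mathlib

section
/- Let g : [0,1] → [0,1] be a concave distortion of vanishing order p ≥ 1 (i.e. h := g^p is concave with lim_{x↓0} h(x)/x < ∞), let (ν_n)_{n∈ℕ} be probability measures on (X, 𝒳) with ν_n ≪ μ satisfying the sharp large deviation principle with rate I : X → [0,∞] measurable (lim_{n→∞} (1/n) log ν_n(A) = −ess.inf_A I for all A ∈ 𝒳), and define φ(f) := limsup_{n→∞} (1/n) log 𝓔_{ν_n,g}(e^{n f}). Then for every f ∈ L^φ := { f ∈ L⁰ : φ(t f) < ∞ for some t > 1 } the limit lim_{n→∞} (1/n) log 𝓔_{ν_n,g}(e^{n f}) exists and equals ess.sup_X(f − (1/p) I). -/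
open MeasureTheory Filter Set Topology ENNReal

noncomputable section

variable {X : Type*} [MeasurableSpace X]

/-- The distorted expectation `𝓔_{ν,g}(F) = ∫₀^∞ g (ν (F > y)) dy` of a nonnegative
function `F`, for a distortion `g`. -/
def distExp (ν : Measure X) (g : ℝ → ℝ) (F : X → ℝ) : ℝ≥0∞ :=
  ∫⁻ y in Ioi (0:ℝ), ENNReal.ofReal (g ((ν {x | y < F x}).toReal))

/-- The distorted upper Varadhan functional
`φ f = limsup_n (1/n) log 𝓔_{ν_n,g}(e^{n f})`. -/
def distVaradhan (ν : ℕ → Measure X) (g : ℝ → ℝ) (f : X → ℝ) : EReal :=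
  Filter.limsup (fun n : ℕ => (((n : ℝ)⁻¹ : ℝ) : EReal) *
    ENNReal.log (distExp (ν n) g (fun x => Real.exp ((n : ℝ) * f x)))) atTop

theorem EReal.inv_mul_le_coe_iff {r b : ℝ} (hr : 0 < r) (z : EReal) :
    ((r⁻¹ : ℝ) : EReal) * z ≤ b ↔ z ≤ ((r * b : ℝ) : EReal) := by
  induction z using EReal.rec with
  | bot => simp [EReal.coe_mul_bot_of_pos (inv_pos.2 hr)]
  | top =>
    rw [EReal.coe_mul_top_of_pos (inv_pos.2 hr)]
    simp only [top_le_iff, EReal.coe_ne_top]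
  | coe x =>
    norm_cast
    rw [inv_mul_le_iff₀ hr]

theorem EReal.coe_le_inv_mul_iff {r b : ℝ} (hr : 0 < r) (z : EReal) :
    (b : EReal) ≤ ((r⁻¹ : ℝ) : EReal) * z ↔ ((r * b : ℝ) : EReal) ≤ z := by
  induction z using EReal.rec with
  | bot =>
    rw [EReal.coe_mul_bot_of_pos (inv_pos.2 hr)]
    simp only [le_bot_iff, EReal.coe_ne_bot]
  | top => simp [EReal.coe_mul_top_of_pos (inv_pos.2 hr)]
  | coe x =>
    norm_cast
    rw [le_inv_mul_iff₀ hr]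

theorem inv_mul_log_le_iff {n : ℕ} (hn : 0 < n) (b : ℝ) (u : ℝ≥0∞) :
    (((n : ℝ)⁻¹ : ℝ) : EReal) * ENNReal.log u ≤ b ↔ u ≤ ENNReal.ofReal (Real.exp (n * b)) := by
  rw [EReal.inv_mul_le_coe_iff (by positivity), ← ENNReal.log_le_log_iff (x := u),
    ENNReal.log_ofReal_of_pos (Real.exp_pos _), Real.log_exp]

theorem le_inv_mul_log_iff {n : ℕ} (hn : 0 < n) (b : ℝ) (u : ℝ≥0∞) :
    (b : EReal) ≤ (((n : ℝ)⁻¹ : ℝ) : EReal) * ENNReal.log u ↔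
      ENNReal.ofReal (Real.exp (n * b)) ≤ u := by
  rw [EReal.coe_le_inv_mul_iff (by positivity), ← ENNReal.log_le_log_iff (y := u),
    ENNReal.log_ofReal_of_pos (Real.exp_pos _), Real.log_exp]

/-- A logarithmic limit is identified by exponential upper and lower bounds. -/
theorem tendsto_inv_mul_log_of_eventually {u : ℕ → ℝ≥0∞} {S : EReal}
    (hlow : ∀ b : ℝ, (b : EReal) < S → ∀ᶠ n : ℕ in atTop,
      ENNReal.ofReal (Real.exp (n * b)) ≤ u n)
    (hup : ∀ b : ℝ, S < b → ∀ᶠ n : ℕ in atTop, u n ≤ ENNReal.ofReal (Real.exp (n * b))) :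
    Tendsto (fun n : ℕ => (((n : ℝ)⁻¹ : ℝ) : EReal) * ENNReal.log (u n)) atTop (𝓝 S) := by
  refine tendsto_order.2 ⟨fun a ha => ?_, fun a ha => ?_⟩
  · obtain ⟨b, hab, hb⟩ := EReal.lt_iff_exists_real_btwn.1 ha
    filter_upwards [hlow b hb, eventually_gt_atTop 0] with n h hn
    exact hab.trans_le ((le_inv_mul_log_iff hn b _).2 h)
  · obtain ⟨b, hb, hba⟩ := EReal.lt_iff_exists_real_btwn.1 ha
    filter_upwards [hup b hb, eventually_gt_atTop 0] with n h hn
    exact ((inv_mul_log_le_iff hn b _).2 h).trans_lt hba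

/-- If `g ^ p` is concave with slope `L` at `0`, then `g ^ p` lies between `x` and `L * x`. -/
theorem rpow_bounds_of_vanishing_order {g : ℝ → ℝ} {p : ℝ} (hp : 0 < p)
    (hg0 : g 0 = 0) (hg1 : g 1 = 1)
    (hconc : ConcaveOn ℝ (Icc (0:ℝ) 1) (fun x => g x ^ p)) {L : ℝ}
    (hL : Tendsto (fun x => g x ^ p / x) (𝓝[Ioc (0:ℝ) 1] 0) (𝓝 L)) :
    ∀ x ∈ Icc (0:ℝ) 1, x ≤ g x ^ p ∧ g x ^ p ≤ L * x := by
  intro x hx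
  have scale : ∀ z ∈ Icc (0:ℝ) 1, ∀ s ∈ Icc (0:ℝ) 1, s * g z ^ p ≤ g (s * z) ^ p := by
    intro z hz s hs
    have h := hconc.2 hz (left_mem_Icc.2 zero_le_one) hs.1 (sub_nonneg.2 hs.2)
      (add_sub_cancel s 1)
    simpa [hg0, Real.zero_rpow hp.ne'] using h
  constructor
  · simpa [hg1] using scale 1 (right_mem_Icc.2 zero_le_one) x hx
  · rcases hx.1.eq_or_lt with rfl | hx0
    · simp [hg0, Real.zero_rpow hp.ne']
    have : (𝓝[Ioc (0:ℝ) 1] 0).NeBot := by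
      rw [nhdsWithin_Ioc_eq_nhdsGT zero_lt_one]
      infer_instance
    rw [← div_le_iff₀ hx0]
    refine ge_of_tendsto hL ?_
    have hlt : ∀ᶠ y in 𝓝[Ioc (0:ℝ) 1] 0, y < x := nhdsWithin_le_nhds (eventually_lt_nhds hx0)
    filter_upwards [hlt, self_mem_nhdsWithin] with y hyx hy
    have h := scale x hx (y / x) ⟨by positivity [hy.1], (div_le_one hx0).2 hyx.le⟩
    rw [div_mul_cancel₀ _ hx0.ne'] at h
    rw [le_div_iff₀ hy.1]
    calc g x ^ p / x * y = y / x * g x ^ p := by ring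
      _ ≤ g y ^ p := h

theorem toReal_measure_mem_Icc (ν : Measure X) [IsProbabilityMeasure ν] (A : Set X) :
    (ν A).toReal ∈ Icc (0:ℝ) 1 :=
  ⟨ENNReal.toReal_nonneg, measureReal_le_one⟩

theorem comp_toReal_measure_mono {ν : Measure X} [IsProbabilityMeasure ν] {g : ℝ → ℝ}
    (hg : MonotoneOn g (Icc (0:ℝ) 1)) {A B : Set X} (h : A ⊆ B) :
    g (ν A).toReal ≤ g (ν B).toReal :=
  hg (toReal_measure_mem_Icc ν A) (toReal_measure_mem_Icc ν B)
    (ENNReal.toReal_mono (measure_ne_top _ _) (measure_mono h))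

/-- Markov's inequality for distorted expectations. -/
theorem mul_distortion_le_distExp {ν : Measure X} [IsProbabilityMeasure ν] {g : ℝ → ℝ}
    (hg : MonotoneOn g (Icc (0:ℝ) 1)) {F : X → ℝ} {w : ℝ} {A : Set X} (hA : ∀ x ∈ A, w ≤ F x) :
    ENNReal.ofReal (g (ν A).toReal) * ENNReal.ofReal w ≤ distExp ν g F := by
  calc ENNReal.ofReal (g (ν A).toReal) * ENNReal.ofReal w
      = ∫⁻ _ in Ioo 0 w, ENNReal.ofReal (g (ν A).toReal) := by
        rw [setLIntegral_const, Real.volume_Ioo, sub_zero]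
    _ ≤ ∫⁻ y in Ioo 0 w, ENNReal.ofReal (g ((ν {x | y < F x}).toReal)) :=
        setLIntegral_mono' measurableSet_Ioo fun y hy => ENNReal.ofReal_le_ofReal <|
          comp_toReal_measure_mono hg fun x hx => hy.2.trans_le (hA x hx)
    _ ≤ distExp ν g F := lintegral_mono_set Ioo_subset_Ioi_self

/-- The part of a distorted expectation above a level is controlled by a higher moment. -/
theorem setLIntegral_Ioi_distortion_le {ν : Measure X} [IsProbabilityMeasure ν] {g : ℝ → ℝ}
    (hg : MonotoneOn g (Icc (0:ℝ) 1)) {f : X → ℝ} {t M B r : ℝ} (ht : 1 < t)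
    (hB : distExp ν g (fun x => Real.exp (r * (t * f x))) ≤ ENNReal.ofReal (Real.exp (r * B))) :
    ∫⁻ y in Ioi (Real.exp (r * M)), ENNReal.ofReal (g ((ν {x | y < Real.exp (r * f x)}).toReal)) ≤
      ENNReal.ofReal (Real.exp (r * (B - M * (t - 1))) / (t - 1)) := by
  have hint := integrableOn_Ioi_rpow_of_lt (neg_lt_neg ht) (Real.exp_pos (r * M))
  calc ∫⁻ y in Ioi (Real.exp (r * M)),
        ENNReal.ofReal (g ((ν {x | y < Real.exp (r * f x)}).toReal))
      ≤ ∫⁻ y in Ioi (Real.exp (r * M)), ENNReal.ofReal (Real.exp (r * B) * y ^ (-t)) := by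
        refine setLIntegral_mono' measurableSet_Ioi fun y hy => ?_
        have hy0 : 0 < y := (Real.exp_pos _).trans hy
        have hyt : 0 < y ^ t := Real.rpow_pos_of_pos hy0 t
        have h := (mul_distortion_le_distExp (ν := ν) (w := y ^ t)
          (A := {x | y < Real.exp (r * f x)}) (F := fun x => Real.exp (r * (t * f x))) hg
          (fun x hx => by
            calc y ^ t ≤ Real.exp (r * f x) ^ t :=
                  Real.rpow_le_rpow hy0.le (le_of_lt hx) (by linarith)
              _ = Real.exp (r * (t * f x)) := by rw [← Real.exp_mul]; ring_nf)).trans hB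
        rw [← ENNReal.ofReal_mul' hyt.le, ENNReal.ofReal_le_ofReal_iff (Real.exp_pos _).le,
          ← le_div_iff₀ hyt] at h
        rw [Real.rpow_neg hy0.le, ← div_eq_mul_inv]
        exact ENNReal.ofReal_le_ofReal h
    _ = ENNReal.ofReal (Real.exp (r * (B - M * (t - 1))) / (t - 1)) := by
        rw [← ofReal_integral_eq_lintegral_ofReal (hint.const_mul _)
          ((ae_restrict_iff' measurableSet_Ioi).2 <| ae_of_all _ fun y hy => by
            have : 0 < y := (Real.exp_pos _).trans hy
            positivity),
          integral_const_mul, integral_Ioi_rpow_of_lt (neg_lt_neg ht) (Real.exp_pos _),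
          ← Real.exp_mul]
        congr 1
        have e : r * (B - M * (t - 1)) = r * B + r * M * (-t + 1) := by ring
        rw [e, Real.exp_add, show -t + 1 = -(t - 1) by ring, neg_div_neg_eq, mul_div_assoc]

/-- Exponential lower bound for the distorted exponential moments, from an exponential lower
bound for the probability of one superlevel set. -/
theorem eventually_exp_le_distExp {ν : ℕ → Measure X} [∀ n, IsProbabilityMeasure (ν n)]
    {g : ℝ → ℝ} {p : ℝ} (hp : 0 < p) (hg : MonotoneOn g (Icc (0:ℝ) 1))
    (hgmaps : ∀ x ∈ Icc (0:ℝ) 1, g x ∈ Icc (0:ℝ) 1) (hlow : ∀ x ∈ Icc (0:ℝ) 1, x ≤ g x ^ p)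
    {f : X → ℝ} {a s : ℝ}
    (h : ∀ᶠ n : ℕ in atTop, ENNReal.ofReal (Real.exp (n * (p * s))) ≤ ν n {x | a ≤ f x}) :
    ∀ᶠ n : ℕ in atTop, ENNReal.ofReal (Real.exp (n * (a + s))) ≤
      distExp (ν n) g (fun x => Real.exp (n * f x)) := by
  filter_upwards [h] with n hn
  refine le_trans ?_ (mul_distortion_le_distExp (w := Real.exp (n * a)) (A := {x | a ≤ f x}) hg
    fun x hx => Real.exp_le_exp.2 (mul_le_mul_of_nonneg_left hx n.cast_nonneg))
  have hmem := toReal_measure_mem_Icc (ν n) {x | a ≤ f x}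
  have hs : Real.exp (n * s) ≤ g (ν n {x | a ≤ f x}).toReal := by
    rw [← Real.rpow_le_rpow_iff (Real.exp_pos _).le (hgmaps _ hmem).1 hp, ← Real.exp_mul]
    refine le_trans ?_ (hlow _ hmem)
    rw [mul_assoc, mul_comm s]
    exact (ENNReal.ofReal_le_iff_le_toReal (measure_ne_top _ _)).1 hn
  rw [← ENNReal.ofReal_mul' (Real.exp_pos _).le, mul_add, add_comm, Real.exp_add]
  gcongr

/-- Exponential upper bound for the part of the distorted exponential moments below a level. -/
theorem eventually_setLIntegral_Ioc_distortion_le {ν : ℕ → Measure X}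
    [∀ n, IsProbabilityMeasure (ν n)] {g : ℝ → ℝ} {p L : ℝ} (hp : 0 < p)
    (hg : MonotoneOn g (Icc (0:ℝ) 1))
    (hgmaps : ∀ x ∈ Icc (0:ℝ) 1, g x ∈ Icc (0:ℝ) 1) (hL0 : 0 ≤ L)
    (hup : ∀ x ∈ Icc (0:ℝ) 1, g x ^ p ≤ L * x) {f : X → ℝ} {c δ : ℝ} (hδ : 0 < δ)
    (h : ∀ a s : ℝ, c - a < s → ∀ᶠ n : ℕ in atTop,
      ν n {x | a ≤ f x} ≤ ENNReal.ofReal (Real.exp (n * (p * s)))) (k : ℕ) :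
    ∀ᶠ n : ℕ in atTop, ∫⁻ y in Ioc 0 (Real.exp (n * (c + k * δ))),
        ENNReal.ofReal (g ((ν n {x | y < Real.exp (n * f x)}).toReal)) ≤
      ENNReal.ofReal ((1 + k * L ^ p⁻¹) * Real.exp (n * (c + 2 * δ))) := by
  induction k with
  | zero =>
    refine Eventually.of_forall fun n => ?_
    calc ∫⁻ y in Ioc 0 (Real.exp (n * (c + (0 : ℕ) * δ))),
          ENNReal.ofReal (g ((ν n {x | y < Real.exp (n * f x)}).toReal))
        ≤ ∫⁻ _ in Ioc 0 (Real.exp (n * (c + (0 : ℕ) * δ))), 1 :=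
          setLIntegral_mono' measurableSet_Ioc fun y _ =>
            ENNReal.ofReal_le_one.2 (hgmaps _ (toReal_measure_mem_Icc _ _)).2
      _ = ENNReal.ofReal (Real.exp (n * c)) := by simp
      _ ≤ _ := by
          apply ENNReal.ofReal_le_ofReal
          simp only [Nat.cast_zero, zero_mul, add_zero, one_mul]
          gcongr
          linarith
  | succ k ih =>
    filter_upwards [ih, h (c + k * δ) (-(k * δ) + δ) (by linarith)] with n hn hk
    set a := c + k * δ with ha
    have hmem := toReal_measure_mem_Icc (ν n) {x | a ≤ f x}
    have hle : Real.exp (n * a) ≤ Real.exp (n * (a + δ)) := by gcongr; linarith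
    have hga : g (ν n {x | a ≤ f x}).toReal ≤ L ^ p⁻¹ * Real.exp (n * (-(k * δ) + δ)) := by
      rw [← Real.rpow_le_rpow_iff (hgmaps _ hmem).1 (by positivity) hp,
        Real.mul_rpow (by positivity) (by positivity), Real.rpow_inv_rpow hL0 hp.ne',
        ← Real.exp_mul]
      refine (hup _ hmem).trans (mul_le_mul_of_nonneg_left ?_ hL0)
      rw [mul_assoc, mul_comm _ p]
      exact ENNReal.toReal_le_of_le_ofReal (Real.exp_pos _).le hk
    have hpiece : ∫⁻ y in Ioc (Real.exp (n * a)) (Real.exp (n * (a + δ))),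
          ENNReal.ofReal (g ((ν n {x | y < Real.exp (n * f x)}).toReal)) ≤
        ENNReal.ofReal (L ^ p⁻¹ * Real.exp (n * (c + 2 * δ))) := by
      calc _ ≤ ∫⁻ _ in Ioc (Real.exp (n * a)) (Real.exp (n * (a + δ))),
            ENNReal.ofReal (L ^ p⁻¹ * Real.exp (n * (-(k * δ) + δ))) := by
            refine setLIntegral_mono' measurableSet_Ioc fun y hy => ENNReal.ofReal_le_ofReal <|
              (comp_toReal_measure_mono hg fun x (hx : y < _) => ?_).trans hga
            have h1 := Real.exp_lt_exp.1 (hy.1.trans hx)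
            exact (lt_of_mul_lt_mul_left h1 n.cast_nonneg).le
        _ ≤ _ := by
            rw [setLIntegral_const, Real.volume_Ioc, ← ENNReal.ofReal_mul (by positivity)]
            apply ENNReal.ofReal_le_ofReal
            calc _ ≤ L ^ p⁻¹ * Real.exp (n * (-(k * δ) + δ)) * Real.exp (n * (a + δ)) := by
                  gcongr
                  linarith [Real.exp_pos (n * a)]
              _ = _ := by rw [mul_assoc, ← Real.exp_add, ha]; ring_nf
    have ea : c + (k + 1 : ℕ) * δ = a + δ := by push_cast; rw [ha]; ring
    rw [ea, ← Ioc_union_Ioc_eq_Ioc (Real.exp_pos _).le hle]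
    refine (lintegral_union_le _ _ _).trans ((add_le_add hn hpiece).trans_eq ?_)
    rw [← ENNReal.ofReal_add (by positivity) (by positivity)]
    push_cast
    ring_nf

/-- Exponential upper bound for the distorted exponential moments, from exponential upper
bounds for the probabilities of all superlevel sets and a bound on a higher moment. -/
theorem eventually_distExp_le_exp {ν : ℕ → Measure X} [∀ n, IsProbabilityMeasure (ν n)]
    {g : ℝ → ℝ} {p L : ℝ} (hp : 0 < p) (hg : MonotoneOn g (Icc (0:ℝ) 1))
    (hgmaps : ∀ x ∈ Icc (0:ℝ) 1, g x ∈ Icc (0:ℝ) 1) (hL0 : 0 ≤ L)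
    (hup : ∀ x ∈ Icc (0:ℝ) 1, g x ^ p ≤ L * x) {f : X → ℝ} {b c t : ℝ} (hcb : c < b)
    (ht : 1 < t) (htop : distVaradhan ν g (fun x => t * f x) < ⊤)
    (h : ∀ a s : ℝ, c - a < s → ∀ᶠ n : ℕ in atTop,
      ν n {x | a ≤ f x} ≤ ENNReal.ofReal (Real.exp (n * (p * s)))) :
    ∀ᶠ n : ℕ in atTop, distExp (ν n) g (fun x => Real.exp (n * f x)) ≤
      ENNReal.ofReal (Real.exp (n * b)) := by
  obtain ⟨B, hB, -⟩ := EReal.lt_iff_exists_real_btwn.1 htop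
  obtain ⟨δ, hδ, rfl⟩ : ∃ δ > 0, b = c + 3 * δ := ⟨(b - c) / 3, by linarith, by ring⟩
  obtain ⟨N, hN⟩ := exists_nat_ge (((B - c) / (t - 1) - c) / δ)
  have ht' : 0 < t - 1 := sub_pos.2 ht
  have htail : B - (c + N * δ) * (t - 1) ≤ c := by
    rw [div_le_iff₀ hδ, sub_le_iff_le_add, div_le_iff₀ ht'] at hN
    linarith
  have hK : ∀ᶠ n : ℕ in atTop, 1 + N * L ^ p⁻¹ + 1 / (t - 1) ≤ Real.exp (n * δ) :=
    (Real.tendsto_exp_atTop.comp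
      (tendsto_natCast_atTop_atTop.atTop_mul_const hδ)).eventually_ge_atTop _
  filter_upwards [eventually_lt_of_limsup_lt hB, eventually_gt_atTop 0, hK,
    eventually_setLIntegral_Ioc_distortion_le hp hg hgmaps hL0 hup hδ h N] with n hD hn hKn hlow
  have hhigh := setLIntegral_Ioi_distortion_le (M := c + N * δ) hg ht
    ((inv_mul_log_le_iff hn B _).1 hD.le)
  rw [distExp, ← Ioc_union_Ioi_eq_Ioi (Real.exp_pos (n * (c + N * δ))).le]
  refine (lintegral_union_le _ _ _).trans ((add_le_add hlow hhigh).trans ?_)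
  rw [← ENNReal.ofReal_add (by positivity) (by positivity)]
  apply ENNReal.ofReal_le_ofReal
  calc _ ≤ (1 + N * L ^ p⁻¹) * Real.exp (n * (c + 2 * δ)) +
        Real.exp (n * (c + 2 * δ)) / (t - 1) := by
        gcongr
        linarith
    _ = (1 + N * L ^ p⁻¹ + 1 / (t - 1)) * Real.exp (n * (c + 2 * δ)) := by ring
    _ ≤ Real.exp (n * δ) * Real.exp (n * (c + 2 * δ)) := by gcongr
    _ = _ := by rw [← Real.exp_add]; ring_nf

theorem EReal.coe_sub_inv_mul_le_iff {p : ℝ} (hp : 0 < p) (y c : ℝ) (i : ℝ≥0∞) :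
    (y : EReal) - ((p⁻¹ : ℝ) : EReal) * (i : EReal) ≤ c ↔
      ((p * (y - c) : ℝ) : EReal) ≤ (i : EReal) := by
  induction i with
  | top => simp [EReal.coe_mul_top_of_pos (inv_pos.2 hp)]
  | coe i =>
    change (y : EReal) - ((p⁻¹ : ℝ) : EReal) * ((i : ℝ) : EReal) ≤ c ↔
      ((p * (y - c) : ℝ) : EReal) ≤ ((i : ℝ) : EReal)
    norm_cast
    rw [sub_le_comm, le_inv_mul_iff₀ hp]

/-- If `c` lies above the essential supremum of `f - I / p`, then the rate on each superlevel
set of `f` is bounded below. -/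
theorem le_essInf_restrict_of_essSup_lt {μ : Measure X} {f : X → ℝ} (hf : Measurable f)
    {I : X → ℝ≥0∞} {p c : ℝ} (hp : 0 < p)
    (hc : essSup (fun x => (f x : EReal) - ((p⁻¹ : ℝ) : EReal) * (I x : EReal)) μ < c) (a : ℝ) :
    ((p * (a - c) : ℝ) : EReal) ≤
      essInf (fun x => (I x : EReal)) (μ.restrict {x | a ≤ f x}) := by
  refine le_essInf_of_ae_le _ ((ae_restrict_iff' (measurableSet_le measurable_const hf)).2 ?_)
  filter_upwards [ae_lt_of_essSup_lt hc] with x hx hax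
  refine le_trans ?_ ((EReal.coe_sub_inv_mul_le_iff hp _ _ _).1 hx.le)
  have : a ≤ f x := hax
  exact EReal.coe_le_coe_iff.2 (by gcongr)

/-- If `c` lies below the essential supremum of `f - I / p`, then the rate on some superlevel
set of `f` is bounded above. -/
theorem exists_essInf_restrict_le_of_lt_essSup {μ : Measure X} {f : X → ℝ} (hf : Measurable f)
    {I : X → ℝ≥0∞} {p c : ℝ} (hp : 0 < p)
    (hc : c < essSup (fun x => (f x : EReal) - ((p⁻¹ : ℝ) : EReal) * (I x : EReal)) μ) :
    ∃ a : ℝ, essInf (fun x => (I x : EReal)) (μ.restrict {x | a ≤ f x}) ≤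
      ((p * (a - c) : ℝ) : EReal) := by
  by_contra! hcon
  refine hc.not_ge (essSup_le_of_ae_le _ ?_)
  have hall : ∀ᵐ x ∂μ, ∀ r : ℚ, (r : ℝ) ≤ f x → ((p * (r - c) : ℝ) : EReal) < (I x : EReal) :=
    ae_all_iff.2 fun r => (ae_restrict_iff' (measurableSet_le measurable_const hf)).1
      (ae_lt_of_lt_essInf (hcon r))
  filter_upwards [hall] with x hx
  rw [EReal.coe_sub_inv_mul_le_iff hp]
  refine le_of_forall_lt fun z hz => ?_
  obtain ⟨s, hzs, hs⟩ := EReal.lt_iff_exists_real_btwn.1 hz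
  have hs' : c + s / p < f x := by
    have := EReal.coe_lt_coe_iff.1 hs
    rw [← lt_sub_iff_add_lt', div_lt_iff₀' hp]
    exact this
  obtain ⟨r, hr, hrf⟩ := exists_rat_btwn hs'
  refine hzs.trans (lt_trans (EReal.coe_lt_coe_iff.2 ?_) (hx r hrf.le))
  rwa [← lt_sub_iff_add_lt', div_lt_iff₀' hp] at hr

/-- If `g` is a concave distortion of vanishing order `p` and `(ν n)` satisfies the sharp
LDP with rate `I`, then for every `f ∈ L^φ` the limit
`lim_n (1/n) log 𝓔_{ν_n,g}(e^{n f})` exists and equals `ess.sup_X (f - (1/p) I)`. -/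
theorem distorted_laplace_principle
    (μ : Measure X) [IsProbabilityMeasure μ]
    (g : ℝ → ℝ) (p : ℝ) (hp : 1 ≤ p)
    (hgmono : MonotoneOn g (Icc (0:ℝ) 1))
    (hgmaps : ∀ x ∈ Icc (0:ℝ) 1, g x ∈ Icc (0:ℝ) 1)
    (hg0 : g 0 = 0) (hg1 : g 1 = 1)
    (hgconc : ConcaveOn ℝ (Icc (0:ℝ) 1) g)
    (hconc : ConcaveOn ℝ (Icc (0:ℝ) 1) (fun x => g x ^ p))
    (hfin : ∃ L : ℝ, Tendsto (fun x => g x ^ p / x) (𝓝[Ioc (0:ℝ) 1] 0) (𝓝 L))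
    (ν : ℕ → Measure X) (hprob : ∀ n, IsProbabilityMeasure (ν n))
    (hac : ∀ n, ν n ≪ μ)
    (I : X → ℝ≥0∞) (hI : Measurable I)
    (hLDP : ∀ A : Set X, MeasurableSet A →
      Tendsto (fun n : ℕ => (((n : ℝ)⁻¹ : ℝ) : EReal) * ENNReal.log (ν n A)) atTop
        (𝓝 (-(essInf (fun x => (I x : EReal)) (μ.restrict A))))) :
    ∀ f : X → ℝ, Measurable f →
      (∃ t : ℝ, 1 < t ∧ distVaradhan ν g (fun x => t * f x) < ⊤) →
      Tendsto (fun n : ℕ => (((n : ℝ)⁻¹ : ℝ) : EReal) *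
          ENNReal.log (distExp (ν n) g (fun x => Real.exp ((n : ℝ) * f x)))) atTop
        (𝓝 (essSup (fun x => (f x : EReal) - ((p⁻¹ : ℝ) : EReal) * (I x : EReal)) μ)) := by
  intro f hf ⟨t, ht, htop⟩
  have hp0 : 0 < p := zero_lt_one.trans_le hp
  obtain ⟨L, hL⟩ := hfin
  have hbd := rpow_bounds_of_vanishing_order hp0 hg0 hg1 hconc hL
  have hL0 : 0 ≤ L := by
    have h := hbd 1 (right_mem_Icc.2 zero_le_one)
    linarith [h.1, h.2]
  have hset : ∀ a : ℝ, MeasurableSet {x | a ≤ f x} := fun a =>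
    measurableSet_le measurable_const hf
  refine tendsto_inv_mul_log_of_eventually (fun b hb => ?_) (fun b hb => ?_)
  · obtain ⟨c, hbc, hc⟩ := EReal.lt_iff_exists_real_btwn.1 hb
    obtain ⟨a, ha⟩ := exists_essInf_restrict_le_of_lt_essSup hf hp0 hc
    have hrate : ((p * (b - a) : ℝ) : EReal) <
        -essInf (fun x => (I x : EReal)) (μ.restrict {x | a ≤ f x}) := by
      refine lt_of_lt_of_le ?_ (EReal.neg_le_neg_iff.2 ha)
      rw [← EReal.coe_neg, EReal.coe_lt_coe_iff]
      have := mul_lt_mul_of_pos_left (EReal.coe_lt_coe_iff.1 hbc) hp0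
      linarith
    have h := eventually_exp_le_distExp (ν := ν) (f := f) (a := a) (s := b - a) hp0 hgmono hgmaps
      (fun x hx => (hbd x hx).1) (by
        filter_upwards [(hLDP _ (hset a)).eventually_const_lt hrate, eventually_gt_atTop 0]
          with n hn hpos
        exact (le_inv_mul_log_iff hpos _ _).1 hn.le)
    simpa using h
  · obtain ⟨c, hc, hcb⟩ := EReal.lt_iff_exists_real_btwn.1 hb
    refine eventually_distExp_le_exp hp0 hgmono hgmaps hL0 (fun x hx => (hbd x hx).2)
      (EReal.coe_lt_coe_iff.1 hcb) ht htop fun a s has => ?_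
    have hrate : -essInf (fun x => (I x : EReal)) (μ.restrict {x | a ≤ f x}) <
        ((p * s : ℝ) : EReal) := by
      refine (EReal.neg_le_neg_iff.2 (le_essInf_restrict_of_essSup_lt hf hp0 hc a)).trans_lt ?_
      rw [← EReal.coe_neg, EReal.coe_lt_coe_iff]
      have := mul_lt_mul_of_pos_left has hp0
      linarith
    filter_upwards [(hLDP _ (hset a)).eventually_lt_const hrate, eventually_gt_atTop 0]
      with n hn hpos
    exact (inv_mul_log_le_iff hpos _ _).1 hn.le
end
end

section
/- Let (𝓔_n)_{n∈ℕ} be a sequence of sublinear expectations on the nonnegative elements of L⁰, i.e. maps 𝓔_n : L⁰₊ → [0,∞] with (a) 𝓔_n(a) = a for every constant a ≥ 0, (b) 𝓔_n(f) ≤ 𝓔_n(g) whenever f ≤ g μ-a.s., (c) 𝓔_n(f + g) ≤ 𝓔_n(f) + 𝓔_n(g), and (d) 𝓔_n(a f) = a 𝓔_n(f) for all constants a ≥ 0. Then φ(f) := limsup_{n→∞} (1/n) log 𝓔_n(e^{n f}) defines a maxitive monetary risk measure on L⁰: φ satisfies (N) φ(0) = 0, (M) monotonicity with respect to μ-a.s.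 order, (T) φ(f + c) = φ(f) + c for c ∈ ℝ, and φ(f ∨ g) ≤ φ(f) ∨ φ(g) for all f, g ∈ L⁰. -/
open MeasureTheory Filter Set Topology ENNReal

noncomputable section

variable {X : Type*} [MeasurableSpace X]

/-- `E` is a sublinear expectation on the nonnegative elements of `L⁰`: it is constant
preserving, monotone w.r.t. the μ-a.s. order, subadditive, and positively homogeneous. -/
def IsSublinearExpectation (μ : Measure X) (E : (X → ℝ) → ℝ≥0∞) : Prop :=
  (∀ a : ℝ, 0 ≤ a → E (fun _ => a) = ENNReal.ofReal a) ∧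
  (∀ f g : X → ℝ, Measurable f → Measurable g → (∀ᵐ x ∂μ, 0 ≤ f x) →
    (∀ᵐ x ∂μ, 0 ≤ g x) → (∀ᵐ x ∂μ, f x ≤ g x) → E f ≤ E g) ∧
  (∀ f g : X → ℝ, Measurable f → Measurable g → (∀ᵐ x ∂μ, 0 ≤ f x) →
    (∀ᵐ x ∂μ, 0 ≤ g x) → E (fun x => f x + g x) ≤ E f + E g) ∧
  (∀ f : X → ℝ, Measurable f → (∀ᵐ x ∂μ, 0 ≤ f x) → ∀ a : ℝ, 0 ≤ a →
    E (fun x => a * f x) = ENNReal.ofReal a * E f)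

open ExpGrowth in
/-- Multiplying a sequence by `exp (n c)` shifts its upper exponential growth by `c`. -/
theorem expGrowthSup_ofReal_exp_mul (c : ℝ) (u : ℕ → ℝ≥0∞) :
    expGrowthSup (fun n => ENNReal.ofReal (Real.exp (n * c)) * u n) = expGrowthSup u + c := by
  have hexp : (fun n : ℕ => ENNReal.ofReal (Real.exp (n * c))) =
      fun n : ℕ => EReal.exp ((c : EReal) * n) := by
    funext n
    rw [← EReal.exp_coe, mul_comm, EReal.coe_mul, EReal.coe_natCast]
  have hsup : expGrowthSup (fun n : ℕ => ENNReal.ofReal (Real.exp (n * c))) = c := by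
    rw [hexp, expGrowthSup_exp]
  have hinf : expGrowthInf (fun n : ℕ => ENNReal.ofReal (Real.exp (n * c))) = c := by
    rw [hexp, expGrowthInf_exp]
  change expGrowthSup ((fun n : ℕ => ENNReal.ofReal (Real.exp (n * c))) * u) = _
  rw [add_comm]
  apply le_antisymm
  · refine (expGrowthSup_mul_le (.inl ?_) (.inl ?_)).trans_eq (by rw [hsup]) <;> simp [hsup]
  · exact (le_of_eq (by rw [hinf])).trans le_expGrowthSup_mul'

/-- Given a sequence of sublinear expectations `E n`, the functional
`φ f = limsup_n (1/n) log E_n (e^{n f})` is a maxitive monetary risk measure on `L⁰`: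
it is normalized, monotone, translation invariant and maxitive. -/
theorem sublinearExpectation_limsup_maxitive
    (μ : Measure X) [IsProbabilityMeasure μ]
    (E : ℕ → (X → ℝ) → ℝ≥0∞) (hE : ∀ n, IsSublinearExpectation μ (E n))
    (φ : (X → ℝ) → EReal)
    (hφ : ∀ f : X → ℝ, φ f = Filter.limsup (fun n : ℕ => (((n : ℝ)⁻¹ : ℝ) : EReal) *
      ENNReal.log (E n (fun x => Real.exp ((n : ℝ) * f x)))) atTop) :
    φ (fun _ => 0) = 0 ∧
    (∀ f g : X → ℝ, Measurable f → Measurable g → (∀ᵐ x ∂μ, f x ≤ g x) → φ f ≤ φ g) ∧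
    (∀ f : X → ℝ, Measurable f → ∀ c : ℝ, φ (fun x => f x + c) = φ f + (c : EReal)) ∧
    (∀ f g : X → ℝ, Measurable f → Measurable g →
      φ (fun x => max (f x) (g x)) ≤ max (φ f) (φ g)) := by
  have hφ' : ∀ f : X → ℝ, φ f =
      ExpGrowth.expGrowthSup (fun n => E n (fun x => Real.exp ((n : ℝ) * f x))) := by
    intro f
    rw [hφ, ExpGrowth.expGrowthSup]
    simp_rw [EReal.div_eq_inv_mul, EReal.coe_inv, EReal.coe_natCast]
  have hmeas : ∀ (n : ℕ) {f : X → ℝ}, Measurable f →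
      Measurable (fun x => Real.exp ((n : ℝ) * f x)) := fun n f hf => by fun_prop
  have hpos : ∀ (n : ℕ) (f : X → ℝ), ∀ᵐ x ∂μ, 0 ≤ Real.exp ((n : ℝ) * f x) :=
    fun n f => .of_forall fun x => (Real.exp_pos _).le
  refine ⟨?_, fun f g hf hg hfg => ?_, fun f hf c => ?_, fun f g hf hg => ?_⟩
  · have h1 : ∀ n, E n (fun _ => 1) = 1 := fun n => by simpa using (hE n).1 1 zero_le_one
    simp [hφ', h1, ExpGrowth.expGrowthSup_const]
  · rw [hφ', hφ']
    refine ExpGrowth.expGrowthSup_monotone fun n => ?_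
    refine (hE n).2.1 _ _ (hmeas n hf) (hmeas n hg) (hpos n f) (hpos n g) ?_
    filter_upwards [hfg] with x hx
    gcongr
  · rw [hφ', hφ', ← expGrowthSup_ofReal_exp_mul]
    congr 1
    funext n
    rw [← (hE n).2.2.2 _ (hmeas n hf) (hpos n f) _ (Real.exp_pos _).le]
    congr 1
    funext x
    rw [← Real.exp_add]
    ring_nf
  · rw [hφ', hφ', hφ', ← ExpGrowth.expGrowthSup_add]
    refine ExpGrowth.expGrowthSup_monotone fun n => ?_
    refine le_trans ?_ ((hE n).2.2.1 _ _ (hmeas n hf) (hmeas n hg) (hpos n f) (hpos n g))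
    refine (hE n).2.1 _ _ (hmeas n (hf.max hg)) ((hmeas n hf).add (hmeas n hg)) (hpos n _)
      (.of_forall fun x => by positivity) (.of_forall fun x => ?_)
    rcases max_choice (f x) (g x) with h | h <;> simp only [h]
    · exact le_add_of_nonneg_right (Real.exp_pos _).le
    · exact le_add_of_nonneg_left (Real.exp_pos _).le
end
end

section
/- Let (ν_n)_{n∈ℕ} be probability measures on (X, 𝒳) with ν_n ≪ μ and let (α_n)_{n∈ℕ} ⊂ (0,1) satisfy limsup_{n→∞} ν_n(A)/(1−α_n) ≥ 1 for every A ∈ 𝒳 with μ(A) > 0. Then limsup_{n→∞} AVaR_{ν_n, α_n}(f) = ess.sup_X f for every f ∈ L^∞. -/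
open MeasureTheory Filter Set Topology ENNReal

noncomputable section

variable {X : Type*} [MeasurableSpace X]

/-- Membership in `L^∞(μ)`. -/
def MemLinf (μ : Measure X) (f : X → ℝ) : Prop :=
  Measurable f ∧ ∃ C : ℝ, ∀ᵐ x ∂μ, |f x| ≤ C

/-- Value at Risk of `f` at level `s` under `ν`: `inf {m : ν(f ≤ m) ≥ s}`. -/
def VaR (ν : Measure X) (s : ℝ) (f : X → ℝ) : ℝ :=
  sInf {m : ℝ | ENNReal.ofReal s ≤ ν {x | f x ≤ m}}

/-- Average Value at Risk of `f` at level `α` under `ν`: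
`(1/(1-α)) ∫_α^1 VaR_{ν,s}(f) ds`. -/
def AVaR (ν : Measure X) (α : ℝ) (f : X → ℝ) : ℝ :=
  (1 - α)⁻¹ * ∫ s in α..1, VaR ν s f

section VaRBounds

variable {ν : Measure X} {f : X → ℝ} {C : ℝ}

lemma neg_le_of_mem_VaR_set (hC : ∀ᵐ x ∂ν, |f x| ≤ C) {s : ℝ} (hs : 0 < s) {m : ℝ}
    (hm : m ∈ {m : ℝ | ENNReal.ofReal s ≤ ν {x | f x ≤ m}}) : -C ≤ m := by
  by_contra! h
  have h0 : ν {x | f x ≤ m} = 0 := by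
    refine measure_mono_null (fun x hx => ?_) (ae_iff.1 hC)
    have hx' : f x ≤ m := hx
    have := neg_abs_le (f x)
    simp only [mem_ofPred_eq, not_le]
    linarith
  rw [mem_ofPred_eq, h0] at hm
  have := ENNReal.ofReal_pos.2 hs
  exact absurd hm (not_le.2 this)

lemma bddBelow_VaR_set (hC : ∀ᵐ x ∂ν, |f x| ≤ C) {s : ℝ} (hs : 0 < s) :
    BddBelow {m : ℝ | ENNReal.ofReal s ≤ ν {x | f x ≤ m}} :=
  ⟨-C, fun _ hm => neg_le_of_mem_VaR_set hC hs hm⟩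

lemma mem_VaR_set_of_ae_le [IsProbabilityMeasure ν] {M : ℝ} (hM : ∀ᵐ x ∂ν, f x ≤ M)
    {s : ℝ} (hs : s ≤ 1) : M ∈ {m : ℝ | ENNReal.ofReal s ≤ ν {x | f x ≤ m}} := by
  have h1 : ν {x | f x ≤ M} = 1 := by
    rw [← measure_univ (μ := ν)]
    exact measure_eq_measure_of_null_sdiff (subset_univ _)
      (measure_mono_null (fun x hx => hx.2) (ae_iff.1 hM))
  rw [mem_ofPred_eq, h1]
  exact ENNReal.ofReal_le_one.2 hs

lemma VaR_set_nonempty [IsProbabilityMeasure ν] (hC : ∀ᵐ x ∂ν, |f x| ≤ C)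
    {s : ℝ} (hs : s ≤ 1) : {m : ℝ | ENNReal.ofReal s ≤ ν {x | f x ≤ m}}.Nonempty :=
  ⟨C, mem_VaR_set_of_ae_le (hC.mono fun _ hx => (le_abs_self _).trans hx) hs⟩

lemma VaR_le_of_ae_le [IsProbabilityMeasure ν] (hC : ∀ᵐ x ∂ν, |f x| ≤ C) {M : ℝ}
    (hM : ∀ᵐ x ∂ν, f x ≤ M) {s : ℝ} (hs : s ∈ Ioc (0 : ℝ) 1) : VaR ν s f ≤ M :=
  csInf_le (bddBelow_VaR_set hC hs.1) (mem_VaR_set_of_ae_le hM hs.2)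

lemma neg_le_VaR [IsProbabilityMeasure ν] (hC : ∀ᵐ x ∂ν, |f x| ≤ C) {s : ℝ}
    (hs : s ∈ Ioc (0 : ℝ) 1) : -C ≤ VaR ν s f :=
  le_csInf (VaR_set_nonempty hC hs.2) fun _ hm => neg_le_of_mem_VaR_set hC hs.1 hm

lemma monotoneOn_VaR [IsProbabilityMeasure ν] (hC : ∀ᵐ x ∂ν, |f x| ≤ C) :
    MonotoneOn (fun s => VaR ν s f) (Ioc 0 1) := fun _ hs _ ht hst =>
  csInf_le_csInf (bddBelow_VaR_set hC hs.1) (VaR_set_nonempty hC ht.2)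
    fun _ hm => (ENNReal.ofReal_le_ofReal hst).trans hm

lemma intervalIntegrable_VaR [IsProbabilityMeasure ν] (hC : ∀ᵐ x ∂ν, |f x| ≤ C) {a b : ℝ}
    (ha : a ∈ Ioc (0 : ℝ) 1) (hb : b ∈ Ioc (0 : ℝ) 1) :
    IntervalIntegrable (fun s => VaR ν s f) volume a b :=
  ((monotoneOn_VaR hC).mono (ordConnected_Ioc.uIcc_subset ha hb)).intervalIntegrable

/-- If `f` exceeds `a` with probability at least `p`, then its quantiles at levels above `1 - p`
are at least `a`. -/
lemma le_VaR_of_le_measure [IsProbabilityMeasure ν] (hf : Measurable f)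
    (hC : ∀ᵐ x ∂ν, |f x| ≤ C) {a p s : ℝ} (hp : ENNReal.ofReal p ≤ ν {x | a < f x})
    (hs : s ∈ Ioc (0 : ℝ) 1) (hps : 1 - p < s) : a ≤ VaR ν s f := by
  refine le_csInf (VaR_set_nonempty hC hs.2) fun m hm => ?_
  by_contra! h
  have hsub : {x | f x ≤ m} ⊆ {x | a < f x}ᶜ := fun x hx => by
    have hx' : f x ≤ m := hx
    simp only [mem_compl_iff, mem_ofPred_eq, not_lt]
    linarith
  have hle := hm.trans (measure_mono hsub)
  have hA : MeasurableSet {x | a < f x} := measurableSet_lt measurable_const hf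
  rw [ENNReal.ofReal_le_iff_le_toReal (measure_ne_top _ _), ← measureReal_def,
    probReal_compl_eq_one_sub hA] at hle
  rw [ENNReal.ofReal_le_iff_le_toReal (measure_ne_top _ _), ← measureReal_def] at hp
  linarith

lemma AVaR_le_of_ae_le [IsProbabilityMeasure ν] (hC : ∀ᵐ x ∂ν, |f x| ≤ C) {M : ℝ}
    (hM : ∀ᵐ x ∂ν, f x ≤ M) {α : ℝ} (hα : α ∈ Ioo (0 : ℝ) 1) : AVaR ν α f ≤ M := by
  have hpos : 0 < 1 - α := sub_pos.2 hα.2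
  have h : ∫ s in α..1, VaR ν s f ≤ ∫ _ in α..1, M :=
    intervalIntegral.integral_mono_on hα.2.le
      (intervalIntegrable_VaR hC ⟨hα.1, hα.2.le⟩ ⟨one_pos, le_rfl⟩) (by simp)
      fun s hs => VaR_le_of_ae_le hC hM ⟨hα.1.trans_le hs.1, hs.2⟩
  rw [intervalIntegral.integral_const, smul_eq_mul] at h
  rw [AVaR, inv_mul_le_iff₀ hpos]
  exact h

/-- If `f` exceeds `a` on a `(1 - ε)`-fraction of the tail mass `1 - α`, then its AVaR is at least
the corresponding convex combination of `a` and the lower bound `-C`. -/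
lemma le_AVaR_of_le_measure [IsProbabilityMeasure ν] (hf : Measurable f)
    (hC : ∀ᵐ x ∂ν, |f x| ≤ C) {α a ε : ℝ} (hα : α ∈ Ioo (0 : ℝ) 1) (hε : ε ∈ Ioo (0 : ℝ) 1)
    (hA : ENNReal.ofReal ((1 - ε) * (1 - α)) ≤ ν {x | a < f x}) :
    (1 - ε) * a - ε * C ≤ AVaR ν α f := by
  have hpos : 0 < 1 - α := sub_pos.2 hα.2
  set t := 1 - (1 - ε) * (1 - α) with ht
  have hαt : α < t := by nlinarith [mul_pos hε.1 hpos]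
  have ht1 : t < 1 := by nlinarith [mul_pos (sub_pos.2 hε.2) hpos]
  have ht0 : 0 < t := hα.1.trans hαt
  have hI₁ := intervalIntegrable_VaR hC (a := α) (b := t) ⟨hα.1, hα.2.le⟩ ⟨ht0, ht1.le⟩
  have hI₂ := intervalIntegrable_VaR hC (a := t) (b := 1) ⟨ht0, ht1.le⟩ ⟨one_pos, le_rfl⟩
  have h₁ : ∫ _ in α..t, -C ≤ ∫ s in α..t, VaR ν s f :=
    intervalIntegral.integral_mono_on hαt.le (by simp) hI₁
      fun s hs => neg_le_VaR hC ⟨hα.1.trans_le hs.1, hs.2.trans ht1.le⟩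
  have h₂ : ∫ _ in t..1, a ≤ ∫ s in t..1, VaR ν s f :=
    intervalIntegral.integral_mono_on_of_le_Ioo ht1.le (by simp) hI₂
      fun s hs => le_VaR_of_le_measure hf hC hA ⟨ht0.trans hs.1, hs.2.le⟩ hs.1
  rw [intervalIntegral.integral_const, smul_eq_mul] at h₁ h₂
  rw [AVaR, le_inv_mul_iff₀ hpos, ← intervalIntegral.integral_add_adjacent_intervals hI₁ hI₂]
  refine le_trans (le_of_eq ?_) (add_le_add h₁ h₂)
  rw [ht]
  ring

end VaRBounds

lemma exists_essSup_eq_coe {μ : Measure X} [IsProbabilityMeasure μ] {f : X → ℝ} {C : ℝ}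
    (hC : ∀ᵐ x ∂μ, |f x| ≤ C) :
    ∃ M : ℝ, -C ≤ M ∧ essSup (fun x => (f x : EReal)) μ = M := by
  have hle : essSup (fun x => (f x : EReal)) μ ≤ (C : EReal) :=
    essSup_le_of_ae_le _ (hC.mono fun x hx => EReal.coe_le_coe_iff.2 ((le_abs_self _).trans hx))
  have hge : ((-C : ℝ) : EReal) ≤ essSup (fun x => (f x : EReal)) μ := by
    obtain ⟨x, hx, hx'⟩ := (hC.and (_root_.ae_le_essSup (f := fun x => (f x : EReal)))).exists
    exact (EReal.coe_le_coe_iff.2 (abs_le.1 hx).1).trans hx'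
  lift essSup (fun x => (f x : EReal)) μ to ℝ using
    ⟨(hle.trans_lt (EReal.coe_lt_top C)).ne, ((EReal.bot_lt_coe _).trans_le hge).ne'⟩ with M
  exact ⟨M, EReal.coe_le_coe_iff.1 hge, rfl⟩

/-- If `limsup_n ν_n(A)/(1-α_n) ≥ 1` for every measurable `A` with `μ A > 0`, then
`limsup_n AVaR_{ν_n,α_n}(f) = ess.sup_X f` for every `f ∈ L^∞`. -/
theorem limsup_AVaR_eq_essSup
    (μ : Measure X) [IsProbabilityMeasure μ]
    (ν : ℕ → Measure X) (hprob : ∀ n, IsProbabilityMeasure (ν n))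
    (hac : ∀ n, ν n ≪ μ)
    (α : ℕ → ℝ) (hα : ∀ n, α n ∈ Ioo (0:ℝ) 1)
    (hcond : ∀ A : Set X, MeasurableSet A → 0 < μ A →
      1 ≤ Filter.limsup (fun n => ν n A / ENNReal.ofReal (1 - α n)) atTop) :
    ∀ f : X → ℝ, MemLinf μ f →
      Filter.limsup (fun n => ((AVaR (ν n) (α n) f : ℝ) : EReal)) atTop
        = essSup (fun x => (f x : EReal)) μ := by
  rintro f ⟨hf, C, hC⟩
  obtain ⟨M, hCM, hM⟩ := exists_essSup_eq_coe hC
  have hfM : ∀ᵐ x ∂μ, f x ≤ M := by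
    filter_upwards [_root_.ae_le_essSup (μ := μ) (f := fun x => (f x : EReal))] with x hx
    rwa [hM, EReal.coe_le_coe_iff] at hx
  rw [hM]
  apply le_antisymm
  · refine limsup_le_of_le (by isBoundedDefault) (Eventually.of_forall fun n => ?_)
    have := hprob n
    exact EReal.coe_le_coe_iff.2
      (AVaR_le_of_ae_le ((hac n).ae_le hC) ((hac n).ae_le hfM) (hα n))
  · refine EReal.ge_of_forall_gt_iff_ge.1 fun c hc => ?_
    have hcM : 0 < M - c := sub_pos.2 (EReal.coe_lt_coe_iff.1 hc)
    have hden : 0 < 1 + (M + C) + (M - c) := by linarith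
    obtain ⟨ε, hεdef⟩ : ∃ ε, ε = (M - c) / (1 + (M + C) + (M - c)) := ⟨_, rfl⟩
    have hε0 : 0 < ε := hεdef ▸ div_pos hcM hden
    have hε1 : ε < 1 := by
      rw [hεdef, div_lt_one hden]
      linarith
    have hεM : ε * (1 + (M + C) + (M - c)) = M - c := by
      rw [hεdef, div_mul_cancel₀ _ hden.ne']
    have hμA : 0 < μ {x | M - ε < f x} := by
      rw [pos_iff_ne_zero]
      intro h0
      have hle : essSup (fun x => (f x : EReal)) μ ≤ ((M - ε : ℝ) : EReal) := by
        refine essSup_le_of_ae_le _ ?_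
        have : ∀ᵐ x ∂μ, ¬ M - ε < f x := by simpa [ae_iff] using h0
        exact this.mono fun x hx => EReal.coe_le_coe_iff.2 (not_lt.1 hx)
      rw [hM, EReal.coe_le_coe_iff] at hle
      linarith
    have hlt : ENNReal.ofReal (1 - ε) < 1 := ENNReal.ofReal_lt_one.2 (by linarith)
    have hfreq := frequently_lt_of_lt_limsup (by isBoundedDefault)
      (hlt.trans_le (hcond _ (measurableSet_lt measurable_const hf) hμA))
    refine le_limsup_of_frequently_le (hfreq.mono fun n hn => ?_) (by isBoundedDefault)
    have := hprob n
    have hA : ENNReal.ofReal ((1 - ε) * (1 - α n)) ≤ ν n {x | M - ε < f x} := by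
      rw [ENNReal.ofReal_mul (by linarith)]
      exact ENNReal.mul_le_of_le_div hn.le
    have := le_AVaR_of_le_measure hf ((hac n).ae_le hC) (hα n) ⟨hε0, hε1⟩ hA
    refine EReal.coe_le_coe_iff.2 (le_trans ?_ this)
    nlinarith [mul_pos hε0 hε0, mul_pos hε0 hcM]
end
end

section
/- Let (X, 𝒳, μ) be a probability space with μ atomless and L²(X, 𝒳, μ) separable, and let (g_n)_{n∈ℕ} be a sequence of concave distortions. Then for every f ∈ L^∞ the limit lim_{n→∞} (1/n) log 𝓔_{μ, g_n}(e^{n f}) exists and equals ess.sup_X f. -/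
open MeasureTheory Filter Set Topology ENNReal

noncomputable section

variable {X : Type*} [MeasurableSpace X]

/-- `μ` is atomless: every set of positive measure contains a measurable subset of strictly
smaller positive measure. -/
def AtomlessMeasure (μ : Measure X) : Prop :=
  ∀ A : Set X, MeasurableSet A → 0 < μ A →
    ∃ B, B ⊆ A ∧ MeasurableSet B ∧ 0 < μ B ∧ μ B < μ A

theorem distExp_le_of_ae_le {ν : Measure X} [IsProbabilityMeasure ν] {g : ℝ → ℝ} {F : X → ℝ}
    {K : ℝ} (hg0 : g 0 = 0) (hle : ∀ x ∈ Icc (0:ℝ) 1, g x ≤ 1) (hF : ∀ᵐ x ∂ν, F x ≤ K) :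
    distExp ν g F ≤ ENNReal.ofReal K := by
  have key : ∀ y ∈ Ioi (0:ℝ), ENNReal.ofReal (g ((ν {x | y < F x}).toReal)) ≤
      (Ioo (0:ℝ) K).indicator 1 y := by
    intro y hy
    by_cases hyK : y < K
    · rw [indicator_of_mem (show y ∈ Ioo (0:ℝ) K from ⟨hy, hyK⟩), Pi.one_apply,
        ← ENNReal.ofReal_one]
      exact ENNReal.ofReal_le_ofReal (hle _ ⟨ENNReal.toReal_nonneg, measureReal_le_one⟩)
    · have h0 : ν {x | y < F x} = 0 := by
        have : ∀ᵐ x ∂ν, ¬ y < F x := by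
          filter_upwards [hF] with x hx
          linarith
        simpa [ae_iff] using this
      simp [h0, hg0]
  calc distExp ν g F ≤ ∫⁻ y in Ioi (0:ℝ), (Ioo (0:ℝ) K).indicator 1 y :=
        setLIntegral_mono' measurableSet_Ioi key
    _ ≤ ∫⁻ y, (Ioo (0:ℝ) K).indicator 1 y := setLIntegral_le_lintegral _ _
    _ = ENNReal.ofReal K := by
        rw [lintegral_indicator_one measurableSet_Ioo, Real.volume_Ioo, sub_zero]

theorem ofReal_mul_le_distExp {ν : Measure X} [IsProbabilityMeasure ν] {g : ℝ → ℝ} {F : X → ℝ}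
    {K : ℝ} (hmono : MonotoneOn g (Icc (0:ℝ) 1)) (hconc : ConcaveOn ℝ (Icc (0:ℝ) 1) g)
    (hg0 : g 0 = 0) (hg1 : g 1 = 1) :
    ν {x | K < F x} * ENNReal.ofReal K ≤ distExp ν g F := by
  have hmem : ∀ s : Set X, (ν s).toReal ∈ Icc (0:ℝ) 1 :=
    fun s => ⟨ENNReal.toReal_nonneg, measureReal_le_one⟩
  have hid : ∀ t ∈ Icc (0:ℝ) 1, t ≤ g t := by
    intro t ht
    have := hconc.2 (show (0:ℝ) ∈ Icc (0:ℝ) 1 by simp) (show (1:ℝ) ∈ Icc (0:ℝ) 1 by simp)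
      (sub_nonneg.2 ht.2) ht.1 (by ring)
    simpa [hg0, hg1] using this
  have key : ∀ y ∈ Ioo (0:ℝ) K, ν {x | K < F x} ≤
      ENNReal.ofReal (g ((ν {x | y < F x}).toReal)) := by
    intro y hy
    rw [← ENNReal.ofReal_toReal (measure_ne_top ν {x | K < F x})]
    refine ENNReal.ofReal_le_ofReal ((hid _ (hmem _)).trans (hmono (hmem _) (hmem _) ?_))
    exact measureReal_mono fun x hx => hy.2.trans hx
  calc ν {x | K < F x} * ENNReal.ofReal K = ∫⁻ _ in Ioo (0:ℝ) K, ν {x | K < F x} := by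
        rw [setLIntegral_const, Real.volume_Ioo, sub_zero]
    _ ≤ ∫⁻ y in Ioo (0:ℝ) K, ENNReal.ofReal (g ((ν {x | y < F x}).toReal)) :=
        setLIntegral_mono' measurableSet_Ioo key
    _ ≤ distExp ν g F := lintegral_mono_set Ioo_subset_Ioi_self

/-- If `μ` is atomless, `L²(μ)` is separable, and `(g n)` is any sequence of concave
distortions, then for every `f ∈ L^∞` the limit
`lim_n (1/n) log 𝓔_{μ,g_n}(e^{n f})` exists and equals `ess.sup_X f`. -/
theorem distorted_expectation_limit_essSup
    (μ : Measure X) [IsProbabilityMeasure μ]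
    (hatomless : AtomlessMeasure μ)
    (hsep : TopologicalSpace.SeparableSpace (Lp ℝ 2 μ))
    (g : ℕ → ℝ → ℝ)
    (hmono : ∀ n, MonotoneOn (g n) (Icc (0:ℝ) 1))
    (hconc : ∀ n, ConcaveOn ℝ (Icc (0:ℝ) 1) (g n))
    (hmaps : ∀ n, ∀ x ∈ Icc (0:ℝ) 1, g n x ∈ Icc (0:ℝ) 1)
    (hg0 : ∀ n, g n 0 = 0) (hg1 : ∀ n, g n 1 = 1) :
    ∀ f : X → ℝ, MemLinf μ f →
      Tendsto (fun n : ℕ => (((n : ℝ)⁻¹ : ℝ) : EReal) *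
          ENNReal.log (distExp μ (g n) (fun x => Real.exp ((n : ℝ) * f x)))) atTop
        (𝓝 (essSup (fun x => (f x : EReal)) μ)) := by
  intro f ⟨_, C, hC⟩
  have hle : ∀ᵐ x ∂μ, (f x : EReal) ≤ essSup (fun x => (f x : EReal)) μ := ae_le_essSup
  obtain ⟨M, hM⟩ : ∃ M : ℝ, (M : EReal) = essSup (fun x => (f x : EReal)) μ := by
    obtain ⟨x, hx⟩ := hle.exists
    have hub : essSup (fun x => (f x : EReal)) μ ≤ (C : EReal) := by
      refine essSup_le_of_ae_le _ ?_
      filter_upwards [hC] with x hx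
      exact EReal.coe_le_coe_iff.2 ((le_abs_self _).trans hx)
    exact ⟨_, EReal.coe_toReal (hub.trans_lt (EReal.coe_lt_top _)).ne
      ((EReal.bot_lt_coe _).trans_le hx).ne'⟩
  have hcancel : ∀ n : ℕ, 0 < n → ∀ r : ℝ, (n : ℝ)⁻¹ * (n * r) = r := fun n hn r =>
    inv_mul_cancel_left₀ (Nat.cast_ne_zero.2 hn.ne') r
  rw [← hM] at hle ⊢
  refine tendsto_order.2 ⟨fun a ha => ?_, fun a ha => ?_⟩
  · obtain ⟨c, hac, hcM⟩ := EReal.lt_iff_exists_real_btwn.1 ha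
    have hp : μ {x | c < f x} ≠ 0 := by
      intro h0
      have h1 : ∀ᵐ x ∂μ, ¬ c < f x := by simpa [ae_iff] using h0
      refine hcM.not_ge (hM.trans_le (essSup_le_of_ae_le _ ?_))
      filter_upwards [h1] with x hx
      exact EReal.coe_le_coe_iff.2 (not_lt.1 hx)
    set p : ℝ := (μ {x | c < f x}).toReal
    have hp_pos : 0 < p := ENNReal.toReal_pos hp (measure_ne_top _ _)
    have hlim : Tendsto (fun n : ℕ => (((n : ℝ)⁻¹ * Real.log p + c : ℝ) : EReal)) atTop
        (𝓝 (c : EReal)) := by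
      refine (continuous_coe_real_ereal.tendsto c).comp ?_
      simpa using (tendsto_inv_atTop_nhds_zero_nat (𝕜 := ℝ)).mul_const (Real.log p)
        |>.add_const c
    filter_upwards [hlim.eventually_const_lt hac, eventually_gt_atTop 0] with n hn hn0
    refine hn.trans_le ?_
    have hset : {x | Real.exp (n * c) < Real.exp (n * f x)} = {x | c < f x} := by
      ext x
      simp [Real.exp_lt_exp, mul_lt_mul_iff_right₀, hn0]
    have hlow : ENNReal.ofReal (p * Real.exp (n * c)) ≤
        distExp μ (g n) (fun x => Real.exp ((n : ℝ) * f x)) := by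
      have := ofReal_mul_le_distExp (ν := μ) (F := fun x => Real.exp ((n : ℝ) * f x))
        (K := Real.exp (n * c)) (hmono n) (hconc n) (hg0 n) (hg1 n)
      rwa [hset, ← ENNReal.ofReal_toReal (measure_ne_top μ _),
        ← ENNReal.ofReal_mul ENNReal.toReal_nonneg] at this
    have hlog := ENNReal.log_monotone hlow
    rw [ENNReal.log_ofReal_of_pos (by positivity), Real.log_mul hp_pos.ne' (Real.exp_pos _).ne',
      Real.log_exp] at hlog
    refine le_trans ?_ (mul_le_mul_of_nonneg_left hlog
      (EReal.coe_nonneg.2 (inv_nonneg.2 (Nat.cast_nonneg n))))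
    rw [← EReal.coe_mul, mul_add, hcancel n hn0]
  · filter_upwards [eventually_gt_atTop 0] with n hn0
    refine lt_of_le_of_lt ?_ ha
    have hup : distExp μ (g n) (fun x => Real.exp ((n : ℝ) * f x)) ≤
        ENNReal.ofReal (Real.exp (n * M)) := by
      refine distExp_le_of_ae_le (hg0 n) (fun x hx => (hmaps n x hx).2) ?_
      filter_upwards [hle] with x hx
      exact Real.exp_le_exp.2
        (mul_le_mul_of_nonneg_left (EReal.coe_le_coe_iff.1 hx) (Nat.cast_nonneg n))
    have hlog := ENNReal.log_monotone hup
    rw [ENNReal.log_ofReal_of_pos (Real.exp_pos _), Real.log_exp] at hlog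
    refine (mul_le_mul_of_nonneg_left hlog
      (EReal.coe_nonneg.2 (inv_nonneg.2 (Nat.cast_nonneg n)))).trans ?_
    rw [← EReal.coe_mul, hcancel n hn0]
end
end
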